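/- arXiv:1504.04799 — 7 statements merged into one kernel-verified Lean document; each statement's English description precedes it below -/
import Mathlib

section
/- If M = N, then for every η ∈ ℂ the characteristic polynomial of the UT-AMP iteration matrix factors as det(η I_{2N} − C) = ∏_{i=1}^{N} (η² − α η + α β_i). -/
open Matrix

/-- A block matrix with diagonal blocks has the determinant of a direct sum of `2 × 2` matrices. -/
theorem Matrix.det_fromBlocks_diagonal {n R : Type*} [Fintype n] [DecidableEq n] [CommRing R]
    (a b c d : n → R) :
    (fromBlocks (diagonal a) (diagonal b) (diagonal c) (diagonal d)).det
      = ∏ i, (a i * d i - b i * c i) := by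
  let e : Fin 2 × n ≃ n ⊕ n :=
    (finTwoEquiv.prodCongr (Equiv.refl n)).trans (Equiv.boolProdEquivSum n)
  have h : (fromBlocks (diagonal a) (diagonal b) (diagonal c) (diagonal d)).submatrix e e
      = blockDiagonal fun i => !![a i, b i; c i, d i] := by
    ext ⟨p, i⟩ ⟨q, j⟩
    fin_cases p <;> fin_cases q <;>
      simp [e, blockDiagonal_apply, diagonal_apply, finTwoEquiv, Equiv.boolProdEquivSum]
  rw [← det_submatrix_equiv_self e, h, det_blockDiagonal]
  simp [det_fin_two]

/-- Conjugating a block matrix by `diag(1, V)` with `W * V = 1` preserves its determinant. -/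
theorem Matrix.det_fromBlocks_conj {m n R : Type*} [Fintype m] [DecidableEq m]
    [Fintype n] [DecidableEq n] [CommRing R] {V W : Matrix n n R} (hWV : W * V = 1)
    (A : Matrix m m R) (B : Matrix m n R) (C : Matrix n m R) (D : Matrix n n R) :
    (fromBlocks A (B * V) (W * C) (W * D * V)).det = (fromBlocks A B C D).det := by
  have h : fromBlocks A (B * V) (W * C) (W * D * V)
      = fromBlocks 1 0 0 W * fromBlocks A B C D * fromBlocks 1 0 0 V := by
    simp [fromBlocks_multiply]
  have hdet : W.det * V.det = 1 := by rw [← det_mul, hWV, det_one]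
  rw [h, det_mul, det_mul, det_fromBlocks_zero₂₁, det_fromBlocks_zero₂₁, det_one]
  linear_combination (fromBlocks A B C D).det * hdet

/-- **UT-AMP characteristic polynomial factorization, case M = N.**
If `M = N`, then for every `η ∈ ℂ` the characteristic polynomial of the UT-AMP
iteration matrix factors as `det (η I - C) = ∏ i, (η² - α η + α βᵢ)`. -/
theorem utamp_charpoly_square (N : ℕ) (hN : 0 < N)
    (Λ V : Matrix (Fin N) (Fin N) ℂ)
    (hΛ : ∀ i j, i ≠ j → Λ i j = 0)
    (hV : Vᴴ * V = 1) (hV' : V * Vᴴ = 1)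
    (σ2 τ : ℝ) (hσ2 : 0 < σ2) (hτ : 0 < τ)
    (D : Matrix (Fin N) (Fin N) ℂ)
    (hD : D = ((τ : ℂ) • (Λ * Λᴴ) + (σ2 : ℂ) • (1 : Matrix (Fin N) (Fin N) ℂ))⁻¹)
    (β : Fin N → ℝ)
    (hβ : ∀ i, β i = τ * ‖Λ i i‖ ^ 2 / (τ * ‖Λ i i‖ ^ 2 + σ2))
    (α : ℝ) (hα : α = (1 / N) * ∑ i, β i)
    (Cmat : Matrix (Fin N ⊕ Fin N) (Fin N ⊕ Fin N) ℂ)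
    (hC : Cmat = fromBlocks
      ((τ : ℂ) • (D * (Λ * Λᴴ)))
      (-(D * (Λ * V)))
      (((τ : ℂ) ^ 2) • (Vᴴ * Λᴴ * (D * (Λ * Λᴴ))))
      ((α : ℂ) • (1 : Matrix (Fin N) (Fin N) ℂ) - (τ : ℂ) • (Vᴴ * Λᴴ * (D * (Λ * V))))) :
    ∀ η : ℂ,
      (η • (1 : Matrix (Fin N ⊕ Fin N) (Fin N ⊕ Fin N) ℂ) - Cmat).det
        = ∏ i : Fin N, (η ^ 2 - (α : ℂ) * η + (α : ℂ) * ((β i : ℝ) : ℂ)) := by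
  intro η
  obtain ⟨l, rfl⟩ : ∃ l : Fin N → ℂ, Λ = diagonal l :=
    ⟨fun i => Λ i i, by ext i j; by_cases h : i = j <;> simp [h, hΛ]⟩
  simp only [diagonal_apply_eq] at hβ
  have hpos (i : Fin N) : 0 < τ * ‖l i‖ ^ 2 + σ2 := by positivity
  have hne (i : Fin N) : (τ : ℂ) * (l i * star (l i)) + σ2 ≠ 0 := by
    rw [Complex.star_def, Complex.mul_conj']
    exact_mod_cast (hpos i).ne'
  have hβ' (i : Fin N) : ((β i : ℝ) : ℂ)
      = τ * (l i * star (l i)) * ((τ : ℂ) * (l i * star (l i)) + σ2)⁻¹ := by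
    rw [hβ, Complex.star_def, Complex.mul_conj']
    push_cast
    rw [div_eq_mul_inv]
  obtain ⟨d, hd⟩ : ∃ d : Fin N → ℂ, d = fun i => ((τ : ℂ) * (l i * star (l i)) + σ2)⁻¹ :=
    ⟨_, rfl⟩
  have hD' : D = diagonal d := by
    rw [hD]
    refine inv_eq_left_inv ?_
    rw [diagonal_conjTranspose, diagonal_mul_diagonal, ← diagonal_one, ← diagonal_smul,
      ← diagonal_smul, diagonal_add, diagonal_mul_diagonal]
    congr 1
    ext i
    simpa [hd] using inv_mul_cancel₀ (hne i)
  have hblocks : η • (1 : Matrix (Fin N ⊕ Fin N) (Fin N ⊕ Fin N) ℂ) - Cmat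
      = fromBlocks (diagonal fun i => η - β i) (diagonal (fun i => d i * l i) * V)
        (Vᴴ * diagonal fun i => -(τ * star (l i) * β i))
        (Vᴴ * (diagonal fun i => η - α + β i) * V) := by
    have hscalar : (diagonal fun i => η - α + β i)
        = (η - α) • (1 : Matrix (Fin N) (Fin N) ℂ) + diagonal fun i => (β i : ℂ) := by
      rw [← diagonal_one, ← diagonal_smul, diagonal_add]
      simp
    have hηβ : (diagonal fun i => η - (β i : ℂ))
        = η • (1 : Matrix (Fin N) (Fin N) ℂ) - diagonal fun i => (β i : ℂ) := by
      rw [← diagonal_one, ← diagonal_smul, diagonal_sub]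
      simp
    have hβa : (τ : ℂ) • (diagonal d * (diagonal l * (diagonal l)ᴴ))
        = diagonal fun i => (β i : ℂ) := by
      rw [diagonal_conjTranspose, diagonal_mul_diagonal, diagonal_mul_diagonal, ← diagonal_smul]
      congr 1
      ext i
      simp [hβ', hd]
      ring
    have hβd : (τ : ℂ) • ((diagonal l)ᴴ * (diagonal d * diagonal l))
        = diagonal fun i => (β i : ℂ) := by
      rw [diagonal_conjTranspose, diagonal_mul_diagonal, diagonal_mul_diagonal, ← diagonal_smul]
      congr 1
      ext i
      simp [hβ', hd]
      ring
    have hc : (diagonal fun i => -(τ * star (l i) * β i))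
        = -((τ : ℂ) • ((diagonal l)ᴴ * diagonal fun i => (β i : ℂ))) := by
      rw [diagonal_conjTranspose, diagonal_mul_diagonal, ← diagonal_smul, diagonal_neg]
      congr 1
      ext i
      simp
      ring
    rw [hC, hD', ← fromBlocks_one, fromBlocks_smul, sub_eq_add_neg, fromBlocks_neg, fromBlocks_add,
      hscalar, hηβ, hc, hβa]
    congr 1
    · simp [← Matrix.mul_assoc, diagonal_mul_diagonal]
    · rw [← hβa, sq, mul_smul]
      simp [Matrix.mul_assoc]
    · rw [← hβd, Matrix.mul_add, Matrix.add_mul]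
      simp only [Matrix.mul_smul, Matrix.smul_mul, Matrix.mul_one, hV, Matrix.mul_assoc]
      module
  rw [hblocks, det_fromBlocks_conj hV, det_fromBlocks_diagonal]
  refine Finset.prod_congr rfl fun i _ => ?_
  have hβd : (β i : ℂ) = τ * (l i * star (l i)) * d i := by rw [hβ', hd]
  linear_combination -(β i : ℂ) * hβd
end

section
/- If M > N, then for every η ∈ ℂ the characteristic polynomial of the UT-AMP iteration matrix factors as det(η I_{M+N} − C) = η^{M−N} ∏_{i=1}^{N} (η² − α η + α β_i); in particular exactly M − N of the eigenvalues of C (counted with multiplicity) are zero and the remaining ones are roots of the quadratics η² − α η + α β_i. -/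
open Matrix Polynomial

/-- Conjugating by the shear `fromBlocks 1 0 (τ • L) 1` turns the block matrix into one whose
characteristic matrix has scalar diagonal blocks. -/
theorem det_smul_one_sub_fromBlocks {m n 𝕜 : Type*} [Fintype m] [Fintype n] [DecidableEq m]
    [DecidableEq n] [Field 𝕜] (hmn : Fintype.card n ≤ Fintype.card m) (K : Matrix m n 𝕜)
    (L : Matrix n m 𝕜) (τ α : 𝕜) {η : 𝕜} (hη : η ≠ 0) :
    (η • (1 : Matrix (m ⊕ n) (m ⊕ n) 𝕜) - fromBlocks (τ • (K * L)) (-K) (τ ^ 2 • (L * (K * L)))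
      (α • 1 - τ • (L * K))).det
      = η ^ (Fintype.card m - Fintype.card n)
        * ((η ^ 2 - α * η) • (1 : Matrix n n 𝕜) + (α * τ) • (L * K)).det := by
  have shear : fromBlocks 1 0 (-(τ • L)) 1 * (η • (1 : Matrix (m ⊕ n) (m ⊕ n) 𝕜) -
      fromBlocks (τ • (K * L)) (-K) (τ ^ 2 • (L * (K * L))) (α • 1 - τ • (L * K))) *
      fromBlocks 1 0 (τ • L) 1
      = fromBlocks (η • 1) K (-((α * τ) • L)) ((η - α) • 1) := by
    rw [← fromBlocks_one, fromBlocks_smul, sub_eq_add_neg (fromBlocks _ _ _ _), fromBlocks_neg, fromBlocks_add,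
      fromBlocks_multiply,
      fromBlocks_multiply]
    congr 1
    · simp
    · simp
    · simp [Matrix.mul_add, Matrix.add_mul, Matrix.sub_mul, Matrix.mul_assoc, smul_smul, sq]
      module
    · simp [sub_smul]
      abel
  have hdet := congrArg det shear
  rw [det_mul, det_mul, det_fromBlocks_zero₁₂, det_fromBlocks_zero₁₂] at hdet
  simp only [det_one, one_mul, mul_one] at hdet
  rw [hdet]
  let _ : Invertible (η • (1 : Matrix m m 𝕜)) :=
    ⟨η⁻¹ • 1, by simp [smul_smul, hη], by simp [smul_smul, hη]⟩
  have hinv : ⅟(η • (1 : Matrix m m 𝕜)) = η⁻¹ • 1 := rfl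
  have hschur : (η - α) • (1 : Matrix n n 𝕜) - -((α * τ) • L) * ⅟(η • (1 : Matrix m m 𝕜)) * K
      = η⁻¹ • ((η ^ 2 - α * η) • (1 : Matrix n n 𝕜) + (α * τ) • (L * K)) := by
    rw [hinv, smul_add, smul_smul, smul_smul]
    simp only [Matrix.mul_smul, Matrix.neg_mul, Matrix.smul_mul, smul_smul, Matrix.mul_one,
      smul_neg, sub_neg_eq_add]
    congr 2
    field_simp
  rw [det_fromBlocks₁₁, hschur, det_smul, det_smul, det_one, mul_one, ← mul_assoc, inv_pow,
    pow_sub₀ _ hη hmn]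

theorem isUnit_smul_mul_conjTranspose_add {m n : Type*} [Fintype m] [Fintype n] [DecidableEq m]
    (A : Matrix m n ℂ) {τ σ2 : ℝ} (hτ : 0 ≤ τ) (hσ2 : 0 < σ2) :
    IsUnit ((τ : ℂ) • (A * Aᴴ) + (σ2 : ℂ) • (1 : Matrix m m ℂ)) := by
  open scoped ComplexOrder in
  exact (PosDef.posSemidef_add ((posSemidef_self_mul_conjTranspose A).smul
    (Complex.zero_le_real.2 hτ)) (PosDef.one.smul (Complex.zero_lt_real.2 hσ2))).isUnit

/-- The push-through identity, in the case where `Aᴴ * A` is diagonal. -/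
theorem smul_conjTranspose_mul_inv_mul {m n : Type*} [Fintype m] [Fintype n] [DecidableEq m]
    [DecidableEq n] (A : Matrix m n ℂ) {a : n → ℝ} (hA : Aᴴ * A = diagonal fun j => (a j : ℂ))
    (ha : ∀ j, 0 ≤ a j) {τ σ2 : ℝ} (hτ : 0 ≤ τ) (hσ2 : 0 < σ2) :
    (τ : ℂ) • (Aᴴ * (((τ : ℂ) • (A * Aᴴ) + (σ2 : ℂ) • (1 : Matrix m m ℂ))⁻¹ * A))
      = diagonal fun j => ((τ * a j / (τ * a j + σ2) : ℝ) : ℂ) := by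
  set S := (τ : ℂ) • (A * Aᴴ) + (σ2 : ℂ) • (1 : Matrix m m ℂ)
  set E : Matrix n n ℂ := diagonal fun j => ((τ * a j + σ2 : ℝ) : ℂ)⁻¹
  have hne : ∀ j, ((τ * a j + σ2 : ℝ) : ℂ) ≠ 0 := fun j => by
    have := mul_nonneg hτ (ha j)
    exact_mod_cast (by positivity : τ * a j + σ2 ≠ 0)
  have hSA : S * A = A * diagonal fun j => ((τ * a j + σ2 : ℝ) : ℂ) := by
    have : (diagonal fun j => ((τ * a j + σ2 : ℝ) : ℂ))
        = (τ : ℂ) • (Aᴴ * A) + (σ2 : ℂ) • (1 : Matrix n n ℂ) := by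
      rw [hA, smul_one_eq_diagonal, ← diagonal_smul, diagonal_add]
      simp
    rw [this]
    simp [S, Matrix.add_mul, Matrix.mul_add, Matrix.mul_assoc]
  have hSE : S * (A * E) = A := by
    rw [← Matrix.mul_assoc, hSA, Matrix.mul_assoc, diagonal_mul_diagonal]
    simp only [mul_inv_cancel₀ (hne _), diagonal_one, Matrix.mul_one]
  have hpush : S⁻¹ * A = A * E := by
    have hS := (isUnit_iff_isUnit_det S).1 (isUnit_smul_mul_conjTranspose_add A hτ hσ2)
    conv_lhs => rw [← hSE]
    exact nonsing_inv_mul_cancel_left S _ hS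
  rw [hpush, ← Matrix.mul_assoc, hA, diagonal_mul_diagonal, ← diagonal_smul]
  congr 1
  ext j
  simp [div_eq_mul_inv, mul_assoc]

theorem conjTranspose_mul_self_eq_diagonal {M N : ℕ} (hNM : N ≤ M) {A : Matrix (Fin M) (Fin N) ℂ}
    (hA : ∀ (i : Fin M) (j : Fin N), (i : ℕ) ≠ (j : ℕ) → A i j = 0) :
    Aᴴ * A = diagonal fun j => ((‖A (Fin.castLE hNM j) j‖ ^ 2 : ℝ) : ℂ) := by
  ext j k
  rw [Matrix.mul_apply, Finset.sum_eq_single (Fin.castLE hNM j)]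
  · rcases eq_or_ne j k with rfl | hjk
    · simp [Complex.conj_mul']
    · rw [hA _ k (by simpa [Fin.ext_iff] using hjk), mul_zero, diagonal_apply_ne _ hjk]
  · intro i _ hi
    simp [hA i j (by simpa [Fin.ext_iff] using hi)]
  · simp

theorem det_smul_one_add_smul_conj {n R : Type*} [Fintype n] [DecidableEq n] [CommRing R]
    {U V : Matrix n n R} (hUV : U * V = 1) (a b : R) (d : n → R) :
    (a • (1 : Matrix n n R) + b • (U * (diagonal d * V))).det = ∏ j, (a + b * d j) := by
  have : a • (1 : Matrix n n R) + b • (U * (diagonal d * V))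
      = U * (diagonal (fun j => a + b * d j) * V) := by
    have : (diagonal fun j => a + b * d j) = a • (1 : Matrix n n R) + b • diagonal d := by
      rw [smul_one_eq_diagonal, ← diagonal_smul, diagonal_add]
      rfl
    rw [this]
    simp [Matrix.add_mul, Matrix.mul_add, hUV]
  rw [this, det_mul, det_mul, det_diagonal, mul_left_comm, ← det_mul, hUV, det_one, mul_one]


/-- **UT-AMP characteristic polynomial factorization, case M > N.**
If `M > N`, then `det (η I - C) = η^(M-N) * ∏ i, (η² - α η + α βᵢ)`; in particular,
exactly `M - N` of the eigenvalues of `C` (counted with multiplicity) come as zeros from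
the factor `η^(M-N)` and the remaining ones are roots of the quadratics `η² - α η + α βᵢ`. -/
theorem utamp_charpoly_tall (M N : ℕ) (hM : 0 < M) (hN : 0 < N) (hMN : N < M)
    (Λ : Matrix (Fin M) (Fin N) ℂ)
    (hΛ : ∀ (i : Fin M) (j : Fin N), (i : ℕ) ≠ (j : ℕ) → Λ i j = 0)
    (V : Matrix (Fin N) (Fin N) ℂ)
    (hV : Vᴴ * V = 1) (hV' : V * Vᴴ = 1)
    (σ2 τ : ℝ) (hσ2 : 0 < σ2) (hτ : 0 < τ)
    (D : Matrix (Fin M) (Fin M) ℂ)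
    (hD : D = ((τ : ℂ) • (Λ * Λᴴ) + (σ2 : ℂ) • (1 : Matrix (Fin M) (Fin M) ℂ))⁻¹)
    (β : Fin (Nat.min M N) → ℝ)
    (hβ : ∀ i, β i =
      τ * ‖Λ (Fin.castLE (Nat.min_le_left M N) i) (Fin.castLE (Nat.min_le_right M N) i)‖ ^ 2
        / (τ * ‖Λ (Fin.castLE (Nat.min_le_left M N) i) (Fin.castLE (Nat.min_le_right M N) i)‖ ^ 2
            + σ2))
    (α : ℝ) (hα : α = (1 / N) * ∑ i, β i)
    (Cmat : Matrix (Fin M ⊕ Fin N) (Fin M ⊕ Fin N) ℂ)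
    (hC : Cmat = fromBlocks
      ((τ : ℂ) • (D * (Λ * Λᴴ)))
      (-(D * (Λ * V)))
      (((τ : ℂ) ^ 2) • (Vᴴ * Λᴴ * (D * (Λ * Λᴴ))))
      ((α : ℂ) • (1 : Matrix (Fin N) (Fin N) ℂ) - (τ : ℂ) • (Vᴴ * Λᴴ * (D * (Λ * V))))) :
    (∀ η : ℂ,
      (η • (1 : Matrix (Fin M ⊕ Fin N) (Fin M ⊕ Fin N) ℂ) - Cmat).det
        = η ^ (M - N) *
            ∏ i : Fin (Nat.min M N), (η ^ 2 - (α : ℂ) * η + (α : ℂ) * ((β i : ℝ) : ℂ)))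
    ∧ Cmat.charpoly.roots
        = Multiset.replicate (M - N) (0 : ℂ)
          + ∑ i : Fin (Nat.min M N),
              (X ^ 2 - Polynomial.C (α : ℂ) * X + Polynomial.C ((α : ℂ) * ((β i : ℝ) : ℂ))).roots := by
  have hmin : Nat.min M N = N := Nat.min_eq_right hMN.le
  have hdiag : (τ : ℂ) • (Λᴴ * (D * Λ))
      = diagonal fun j => ((β (Fin.cast hmin.symm j) : ℝ) : ℂ) := by
    rw [hD, smul_conjTranspose_mul_inv_mul Λ (conjTranspose_mul_self_eq_diagonal hMN.le hΛ)
      (fun _ => by positivity) hτ.le hσ2]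
    congr 1
    ext j
    rw [hβ]
    rfl
  have hdet : ∀ η : ℂ, η ≠ 0 → (η • (1 : Matrix (Fin M ⊕ Fin N) (Fin M ⊕ Fin N) ℂ) - Cmat).det
      = η ^ (M - N) *
        ∏ i : Fin (Nat.min M N), (η ^ 2 - (α : ℂ) * η + (α : ℂ) * ((β i : ℝ) : ℂ)) := by
    intro η hη
    have hKL : D * (Λ * V) * (Vᴴ * Λᴴ) = D * (Λ * Λᴴ) := by
      rw [Matrix.mul_assoc, Matrix.mul_assoc Λ, ← Matrix.mul_assoc V, hV', Matrix.one_mul]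
    have hLK : (α * τ : ℂ) • (Vᴴ * Λᴴ * (D * (Λ * V)))
        = (α : ℂ) • (Vᴴ * ((diagonal fun j => ((β (Fin.cast hmin.symm j) : ℝ) : ℂ)) * V)) := by
      rw [← hdiag]
      simp only [Matrix.mul_assoc, Matrix.mul_smul, Matrix.smul_mul, smul_smul]
    have h := det_smul_one_sub_fromBlocks (by simpa using hMN.le) (D * (Λ * V)) (Vᴴ * Λᴴ)
      (τ : ℂ) (α : ℂ) hη
    rw [hKL, hLK, det_smul_one_add_smul_conj hV, Fintype.card_fin, Fintype.card_fin] at h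
    rw [hC, h, ← Equiv.prod_comp (finCongr hmin.symm)]
    rfl
  have hchar : Cmat.charpoly = X ^ (M - N) * ∏ i : Fin (Nat.min M N),
      (X ^ 2 - Polynomial.C (α : ℂ) * X + Polynomial.C ((α : ℂ) * ((β i : ℝ) : ℂ))) := by
    refine Polynomial.eq_of_infinite_eval_eq _ _
      ((Set.finite_singleton (0 : ℂ)).infinite_compl.mono fun η hη => ?_)
    have h := hdet η hη
    rw [smul_one_eq_diagonal, ← Matrix.scalar_apply, ← eval_charpoly] at h
    simpa [eval_prod] using h
  have hmonic (i : Fin (Nat.min M N)) :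
      (X ^ 2 - Polynomial.C (α : ℂ) * X + Polynomial.C ((α : ℂ) * ((β i : ℝ) : ℂ))).Monic := by
    monicity!
  refine ⟨fun η => ?_, ?_⟩
  · have h := congrArg (eval η) hchar
    rw [eval_charpoly] at h
    simpa [eval_prod, smul_one_eq_diagonal] using h
  · have hprod := monic_prod_of_monic Finset.univ _ fun i _ => hmonic i
    rw [hchar, roots_mul ((monic_X_pow _).mul hprod).ne_zero, roots_X_pow,
      roots_prod _ _ hprod.ne_zero, Multiset.nsmul_singleton]
    rfl
end

section
/- If M < N, then for every η ∈ ℂ the characteristic polynomial of the UT-AMP iteration matrix factors as det(η I_{M+N} − C) = (η − α)^{N−M} ∏_{i=1}^{M} (η² − α η + α β_i); in particular exactly N − M of the eigenvalues of C (counted with multiplicity) equal α and the remaining ones are roots of the quadratics η² − α η + α β_i. -/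
open Matrix Polynomial

theorem Matrix.det_smul_one_sub_fromBlocks_mul_pow {m n R : Type*} [Fintype m] [Fintype n]
    [DecidableEq m] [DecidableEq n] [CommRing R] (η a : R)
    (A : Matrix m m R) (B : Matrix m n R) (P : Matrix n m R) :
    (η • (1 : Matrix (m ⊕ n) (m ⊕ n) R) - fromBlocks A (-B) (P * A) (a • 1 - P * B)).det
        * (η - a) ^ Fintype.card m
      = ((η - a) • (η • 1 - A) + η • (B * P)).det * (η - a) ^ Fintype.card n := by
  have key : fromBlocks 1 0 (-P) 1
        * (η • (1 : Matrix (m ⊕ n) (m ⊕ n) R) - fromBlocks A (-B) (P * A) (a • 1 - P * B))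
        * fromBlocks ((η - a) • 1) 0 (η • P) 1
      = fromBlocks ((η - a) • (η • 1 - A) + η • (B * P)) B 0 ((η - a) • 1) := by
    rw [← fromBlocks_one, fromBlocks_smul, sub_eq_add_neg, fromBlocks_neg, fromBlocks_add,
      fromBlocks_multiply, fromBlocks_multiply]
    congr 1 <;>
    · simp [Matrix.mul_add, Matrix.add_mul, Matrix.mul_sub, Matrix.sub_mul, smul_sub, sub_smul]
      try module
  simpa [det_mul, det_fromBlocks_zero₂₁, det_fromBlocks_zero₁₂, det_smul] using congrArg det key

theorem Matrix.mul_conjTranspose_eq_diagonal_of_rectangular {M N : ℕ} (h : M ≤ N)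
    (Λ : Matrix (Fin M) (Fin N) ℂ)
    (hΛ : ∀ (i : Fin M) (j : Fin N), (i : ℕ) ≠ (j : ℕ) → Λ i j = 0) :
    Λ * Λᴴ = diagonal fun i => ((‖Λ i (Fin.castLE h i)‖ ^ 2 : ℝ) : ℂ) := by
  ext i j
  rw [mul_apply, Finset.sum_eq_single (Fin.castLE h i)]
  · rcases eq_or_ne i j with rfl | hij
    · simp [Complex.mul_conj']
    · simp [diagonal_apply_ne _ hij,
        hΛ j (Fin.castLE h i) fun hji => hij (Fin.ext (by simpa using hji.symm))]
  · intro k _ hk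
    rw [hΛ i k fun hik => hk (Fin.ext (by simpa using hik.symm)), zero_mul]
  · simp

/-- **UT-AMP characteristic polynomial factorization, case M < N.**
If `M < N`, then `det (η I - C) = (η - α)^(N-M) * ∏ i, (η² - α η + α βᵢ)`; in particular,
exactly `N - M` of the eigenvalues of `C` (counted with multiplicity) equal `α`, coming from
the factor `(η - α)^(N-M)`, and the remaining ones are roots of the quadratics `η² - α η + α βᵢ`. -/
theorem utamp_charpoly_wide (M N : ℕ) (hM : 0 < M) (hN : 0 < N) (hMN : M < N)
    (Λ : Matrix (Fin M) (Fin N) ℂ)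
    (hΛ : ∀ (i : Fin M) (j : Fin N), (i : ℕ) ≠ (j : ℕ) → Λ i j = 0)
    (V : Matrix (Fin N) (Fin N) ℂ)
    (hV : Vᴴ * V = 1) (hV' : V * Vᴴ = 1)
    (σ2 τ : ℝ) (hσ2 : 0 < σ2) (hτ : 0 < τ)
    (D : Matrix (Fin M) (Fin M) ℂ)
    (hD : D = ((τ : ℂ) • (Λ * Λᴴ) + (σ2 : ℂ) • (1 : Matrix (Fin M) (Fin M) ℂ))⁻¹)
    (β : Fin (Nat.min M N) → ℝ)
    (hβ : ∀ i, β i =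
      τ * ‖Λ (Fin.castLE (Nat.min_le_left M N) i) (Fin.castLE (Nat.min_le_right M N) i)‖ ^ 2
        / (τ * ‖Λ (Fin.castLE (Nat.min_le_left M N) i) (Fin.castLE (Nat.min_le_right M N) i)‖ ^ 2
            + σ2))
    (α : ℝ) (hα : α = (1 / N) * ∑ i, β i)
    (Cmat : Matrix (Fin M ⊕ Fin N) (Fin M ⊕ Fin N) ℂ)
    (hC : Cmat = fromBlocks
      ((τ : ℂ) • (D * (Λ * Λᴴ)))
      (-(D * (Λ * V)))
      (((τ : ℂ) ^ 2) • (Vᴴ * Λᴴ * (D * (Λ * Λᴴ))))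
      ((α : ℂ) • (1 : Matrix (Fin N) (Fin N) ℂ) - (τ : ℂ) • (Vᴴ * Λᴴ * (D * (Λ * V))))) :
    (∀ η : ℂ,
      (η • (1 : Matrix (Fin M ⊕ Fin N) (Fin M ⊕ Fin N) ℂ) - Cmat).det
        = (η - (α : ℂ)) ^ (N - M) *
            ∏ i : Fin (Nat.min M N), (η ^ 2 - (α : ℂ) * η + (α : ℂ) * ((β i : ℝ) : ℂ)))
    ∧ Cmat.charpoly.roots
        = Multiset.replicate (N - M) ((α : ℝ) : ℂ)
          + ∑ i : Fin (Nat.min M N),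
              (X ^ 2 - Polynomial.C (α : ℂ) * X + Polynomial.C ((α : ℂ) * ((β i : ℝ) : ℂ))).roots := by
  have hle : M ≤ N := hMN.le
  have hmin : Nat.min M N = M := Nat.min_eq_left hle
  let b : Fin M → ℝ := fun i => β (Fin.cast hmin.symm i)
  have hprod : ∀ η : ℂ, ∏ i : Fin M, (η ^ 2 - (α : ℂ) * η + (α : ℂ) * (b i : ℂ))
      = ∏ i : Fin (Nat.min M N), (η ^ 2 - (α : ℂ) * η + (α : ℂ) * (β i : ℂ)) := fun η =>
    Fintype.prod_equiv (finCongr hmin.symm) _ _ fun i => rfl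
  have hG := mul_conjTranspose_eq_diagonal_of_rectangular hle Λ hΛ
  have hpos : ∀ i : Fin M, ((τ : ℂ) * ((‖Λ i (Fin.castLE hle i)‖ ^ 2 : ℝ) : ℂ) + σ2) ≠ 0 := by
    intro i
    have : 0 < τ * ‖Λ i (Fin.castLE hle i)‖ ^ 2 + σ2 := by positivity
    exact_mod_cast this.ne'
  have hDdiag : D = diagonal fun i =>
      ((τ : ℂ) * ((‖Λ i (Fin.castLE hle i)‖ ^ 2 : ℝ) : ℂ) + σ2)⁻¹ := by
    rw [hD, hG]
    refine inv_eq_left_inv ?_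
    rw [← diagonal_one, ← diagonal_smul, ← diagonal_smul, diagonal_add, diagonal_mul_diagonal]
    congr 1
    funext i
    simpa using inv_mul_cancel₀ (hpos i)
  have hA : (τ : ℂ) • (D * (Λ * Λᴴ)) = diagonal fun i => (b i : ℂ) := by
    rw [hDdiag, hG, diagonal_mul_diagonal, ← diagonal_smul]
    congr 1
    funext i
    have hbi : b i = τ * ‖Λ i (Fin.castLE hle i)‖ ^ 2
        / (τ * ‖Λ i (Fin.castLE hle i)‖ ^ 2 + σ2) := hβ _
    rw [hbi]
    simp only [Pi.smul_apply, smul_eq_mul]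
    push_cast
    ring
  have hBP : (D * (Λ * V)) * ((τ : ℂ) • (Vᴴ * Λᴴ)) = (τ : ℂ) • (D * (Λ * Λᴴ)) := by
    have : Λ * V * (Vᴴ * Λᴴ) = Λ * Λᴴ := by
      rw [Matrix.mul_assoc, ← Matrix.mul_assoc V, hV', Matrix.one_mul]
    rw [Matrix.mul_smul, Matrix.mul_assoc, this]
  have hC' : Cmat = fromBlocks ((τ : ℂ) • (D * (Λ * Λᴴ))) (-(D * (Λ * V)))
      (((τ : ℂ) • (Vᴴ * Λᴴ)) * ((τ : ℂ) • (D * (Λ * Λᴴ))))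
      ((α : ℂ) • 1 - ((τ : ℂ) • (Vᴴ * Λᴴ)) * (D * (Λ * V))) := by
    rw [hC, Matrix.smul_mul, Matrix.mul_smul, smul_smul, Matrix.smul_mul, sq]
  have hdet_ne : ∀ η : ℂ, η ≠ α →
      (η • (1 : Matrix (Fin M ⊕ Fin N) (Fin M ⊕ Fin N) ℂ) - Cmat).det
        = (η - (α : ℂ)) ^ (N - M) *
            ∏ i : Fin (Nat.min M N), (η ^ 2 - (α : ℂ) * η + (α : ℂ) * ((β i : ℝ) : ℂ)) := by
    intro η hη
    have h := det_smul_one_sub_fromBlocks_mul_pow η (α : ℂ) ((τ : ℂ) • (D * (Λ * Λᴴ)))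
      (D * (Λ * V)) ((τ : ℂ) • (Vᴴ * Λᴴ))
    have hdiag : (η - (α : ℂ)) • (η • (1 : Matrix (Fin M) (Fin M) ℂ)
          - diagonal fun i => (b i : ℂ)) + η • (diagonal fun i => (b i : ℂ))
        = diagonal fun i => η ^ 2 - (α : ℂ) * η + (α : ℂ) * (b i : ℂ) := by
      rw [← diagonal_one, ← diagonal_smul, diagonal_sub, ← diagonal_smul, ← diagonal_smul,
        diagonal_add]
      congr 1
      funext i
      simp only [Pi.smul_apply, smul_eq_mul]
      ring
    rw [← hC', hBP, hA, hdiag, det_diagonal, hprod, Fintype.card_fin, Fintype.card_fin] at h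
    refine mul_right_cancel₀ (pow_ne_zero M (sub_ne_zero.mpr hη)) (h.trans ?_)
    rw [mul_right_comm, ← pow_add, Nat.sub_add_cancel hle, mul_comm]
  have heval : ∀ η : ℂ, Cmat.charpoly.eval η
      = (η • (1 : Matrix (Fin M ⊕ Fin N) (Fin M ⊕ Fin N) ℂ) - Cmat).det := by
    intro η
    rw [eval_charpoly, scalar_apply, smul_one_eq_diagonal]
  have hchar : Cmat.charpoly = (X - Polynomial.C (α : ℂ)) ^ (N - M) *
      ∏ i : Fin (Nat.min M N),
        (X ^ 2 - Polynomial.C (α : ℂ) * X + Polynomial.C ((α : ℂ) * ((β i : ℝ) : ℂ))) := by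
    refine eq_of_infinite_eval_eq _ _
      ((Set.finite_singleton (α : ℂ)).infinite_compl.mono fun η hη => ?_)
    rw [Set.mem_ofPred_eq, heval, hdet_ne η hη]
    simp [eval_prod]
  refine ⟨fun η => ?_, ?_⟩
  · rw [← heval, hchar]
    simp [eval_prod]
  · have hne := Cmat.charpoly_monic.ne_zero
    rw [hchar] at hne ⊢
    rw [roots_mul hne, roots_pow, roots_X_sub_C, Multiset.nsmul_singleton,
      roots_prod _ _ (right_ne_zero_of_mul hne)]
    rfl
end

section
/- Suppose Λ ≠ 0. Then the matrix powers of the UT-AMP iteration matrix converge to zero: Cᵗ → 0 (entrywise) as t → ∞. -/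
open Matrix

/-- In a complex Banach algebra, the powers of an element whose spectrum lies in the open unit
disc converge to zero. -/
theorem tendsto_pow_zero_of_spectrum_norm_lt_one {A : Type*} [NormedRing A] [NormedAlgebra ℂ A]
    [CompleteSpace A] [Nontrivial A] (a : A) (h : ∀ z ∈ spectrum ℂ a, ‖z‖ < 1) :
    Filter.Tendsto (fun t : ℕ => a ^ t) Filter.atTop (nhds 0) := by
  have hr : spectralRadius ℂ a < ((1 : NNReal) : ENNReal) :=
    spectrum.spectralRadius_lt_of_forall_lt a fun z hz => h z hz
  obtain ⟨r, hr₁, hr₂⟩ := ENNReal.lt_iff_exists_nnreal_btwn.1 hr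
  have hr₂ : r < 1 := by exact_mod_cast hr₂
  have hbound : ∀ᶠ t : ℕ in Filter.atTop, ‖a ^ t‖ ≤ (r : ℝ) ^ t := by
    filter_upwards [(spectrum.gelfand_formula a).eventually_lt_const hr₁,
      Filter.eventually_gt_atTop 0] with t ht ht₀
    have ht₀' : (0 : ℝ) < t := by exact_mod_cast ht₀
    rw [one_div, ENNReal.rpow_inv_lt_iff ht₀', ENNReal.rpow_natCast] at ht
    exact_mod_cast ht.le
  exact squeeze_zero_norm' hbound
    (tendsto_pow_atTop_nhds_zero_of_lt_one r.coe_nonneg (by exact_mod_cast hr₂))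

/-- The powers of a complex square matrix all of whose eigenvalues lie in the open unit disc
converge to zero. -/
theorem Matrix.tendsto_pow_zero_of_eigenvalue_norm_lt_one {n : Type*} [Fintype n] [DecidableEq n]
    [Nonempty n] (A : Matrix n n ℂ)
    (h : ∀ (z : ℂ) (v : n → ℂ), v ≠ 0 → A *ᵥ v = z • v → ‖z‖ < 1) :
    Filter.Tendsto (fun t : ℕ => A ^ t) Filter.atTop (nhds 0) := by
  let _ : NormedRing (Matrix n n ℂ) := Matrix.linftyOpNormedRing
  let _ : NormedAlgebra ℂ (Matrix n n ℂ) := Matrix.linftyOpNormedAlgebra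
  have : CompleteSpace (Matrix n n ℂ) := FiniteDimensional.complete ℂ _
  refine tendsto_pow_zero_of_spectrum_norm_lt_one A fun z hz => ?_
  rw [← Matrix.spectrum_toLin', ← Module.End.hasEigenvalue_iff_mem_spectrum] at hz
  obtain ⟨v, hv⟩ := hz.exists_hasEigenvector
  exact h z v hv.2 (by simpa using hv.apply_eq_smul)

/-- A root `z` of `z ^ 2 - α z + α p / (p + c)`, where `0 ≤ α < 1`, `0 ≤ p` and `0 < c`, lies in
the open unit disc. -/
theorem norm_lt_one_of_mul_sub_mul_add_eq {α p c : ℝ} (hα₀ : 0 ≤ α) (hα₁ : α < 1) (hp : 0 ≤ p)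
    (hc : 0 < c) {z : ℂ} (h : z * (z - α) * (p + c) = -(α * p)) : ‖z‖ < 1 := by
  have hre := congrArg Complex.re h
  have him := congrArg Complex.im h
  simp only [Complex.mul_re, Complex.mul_im, Complex.sub_re, Complex.sub_im, Complex.add_re,
    Complex.add_im, Complex.neg_re, Complex.neg_im, Complex.ofReal_re, Complex.ofReal_im] at hre him
  have hpc : 0 < p + c := by linarith
  have hαp : 0 ≤ α * p := mul_nonneg hα₀ hp
  have him' : z.im * (2 * z.re - α) = 0 :=
    (mul_eq_zero.1 (by linear_combination him :
      z.im * (2 * z.re - α) * (p + c) = 0)).resolve_right hpc.ne'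
  rw [← sq_lt_one_iff₀ (norm_nonneg z), Complex.sq_norm, Complex.normSq_apply]
  rcases mul_eq_zero.1 him' with hb | ha
  · rw [hb] at hre ⊢
    by_contra! hz
    have hpos : 0 < z.re * (z.re - α) := by
      rcases le_or_gt z.re 0 with h0 | h0 <;> nlinarith
    nlinarith [mul_pos hpos hpc]
  · have ha' : α = 2 * z.re := by linarith
    have hprod : (z.re * z.re + z.im * z.im) * (p + c) = α * p := by
      rw [ha'] at hre ⊢
      linear_combination -hre
    by_contra! hz
    nlinarith

/-- Eigenvalues of the UT-AMP iteration matrix, with `α` any number in `[0, 1)`, lie in the open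
unit disc. -/
theorem utamp_eigenvalue_norm_lt_one {m n : Type*} [Fintype m] [Fintype n] [DecidableEq m]
    [DecidableEq n] (Λ : Matrix m n ℂ) (V : Matrix n n ℂ) (hV : V * Vᴴ = 1)
    {σ2 τ α : ℝ} (hσ2 : 0 < σ2) (hτ : 0 < τ) (hα₀ : 0 ≤ α) (hα₁ : α < 1)
    (D : Matrix m m ℂ)
    (hD : D = ((τ : ℂ) • (Λ * Λᴴ) + (σ2 : ℂ) • (1 : Matrix m m ℂ))⁻¹)
    (z : ℂ) (v : m ⊕ n → ℂ) (hv : v ≠ 0)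
    (h : fromBlocks
      ((τ : ℂ) • (D * (Λ * Λᴴ)))
      (-(D * (Λ * V)))
      (((τ : ℂ) ^ 2) • (Vᴴ * Λᴴ * (D * (Λ * Λᴴ))))
      ((α : ℂ) • (1 : Matrix n n ℂ) - (τ : ℂ) • (Vᴴ * Λᴴ * (D * (Λ * V)))) *ᵥ v = z • v) :
    ‖z‖ < 1 := by
  open scoped ComplexOrder in
  by_contra! hz
  have hzα : z - α ≠ 0 := by
    intro h0
    rw [sub_eq_zero.1 h0, Complex.norm_real, Real.norm_of_nonneg hα₀] at hz
    linarith
  set E : Matrix m m ℂ := (τ : ℂ) • (Λ * Λᴴ) + (σ2 : ℂ) • (1 : Matrix m m ℂ) with hE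
  have hG : (Λ * Λᴴ).PosSemidef := posSemidef_self_mul_conjTranspose Λ
  have hEpos : E.PosDef :=
    PosDef.posSemidef_add (hG.smul (by exact_mod_cast hτ.le))
      (PosDef.one.smul (by exact_mod_cast hσ2))
  have hED : E * D = 1 := by
    rw [hD]
    exact Matrix.mul_nonsing_inv _ ((Matrix.isUnit_iff_isUnit_det _).1 hEpos.isUnit)
  obtain ⟨x, y, rfl⟩ : ∃ x y, v = Sum.elim x y := ⟨_, _, (Sum.elim_comp_inl_inr v).symm⟩
  set u : m → ℂ := (τ : ℂ) • (D *ᵥ (Λ *ᵥ (Λᴴ *ᵥ x))) - D *ᵥ (Λ *ᵥ (V *ᵥ y)) with hu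
  rw [fromBlocks_mulVec] at h
  have h₁ : u = z • x := by
    have := congrArg (· ∘ Sum.inl) h
    simpa [hu, neg_mulVec, smul_mulVec, ← mulVec_mulVec, sub_eq_add_neg, Function.comp_def,
      funext_iff] using this
  have h₂ : (τ : ℂ) • (Vᴴ *ᵥ (Λᴴ *ᵥ u)) + (α : ℂ) • y = z • y := by
    have := congrArg (· ∘ Sum.inr) h
    simp only [Sum.elim_comp_inr, Sum.elim_comp_inl] at this
    have hr : (z • Sum.elim x y) ∘ Sum.inr = z • y := rfl
    rw [hr] at this
    rw [← this, hu]
    simp only [sub_mulVec, smul_mulVec, ← mulVec_mulVec, mulVec_sub, mulVec_smul, one_mulVec,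
      smul_sub, smul_smul, sq]
    abel
  have hy : (z - α) • y = (τ * z) • (Vᴴ *ᵥ (Λᴴ *ᵥ x)) := by
    rw [sub_smul, ← h₂, h₁]
    simp only [mulVec_smul, smul_smul]
    abel
  have hx : x ≠ 0 := by
    rintro rfl
    simp only [mulVec_zero, smul_zero, smul_eq_zero, hzα, false_or] at hy
    exact hv (by rw [hy]; ext i; cases i <;> rfl)
  have hEx : (z * (z - α)) • (E *ᵥ x) = (-(α * τ : ℂ)) • (Λ *ᵥ (Λᴴ *ᵥ x)) := by
    have hVy : (z - α) • (V *ᵥ y) = (τ * z) • (Λᴴ *ᵥ x) := by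
      rw [← mulVec_smul, hy, mulVec_smul, mulVec_mulVec, hV, one_mulVec]
    have hEu : E *ᵥ u = (τ : ℂ) • (Λ *ᵥ (Λᴴ *ᵥ x)) - Λ *ᵥ (V *ᵥ y) := by
      rw [hu, mulVec_sub, mulVec_smul, mulVec_mulVec _ E D, mulVec_mulVec _ E D, hED, one_mulVec,
        one_mulVec]
    rw [mul_comm, mul_smul, ← mulVec_smul, ← h₁, hEu, smul_sub, ← mulVec_smul Λ _ (V *ᵥ y), hVy,
      mulVec_smul, smul_smul, ← sub_smul]
    congr 1
    ring
  obtain ⟨s, hs, hsx⟩ : ∃ s : ℝ, 0 ≤ s ∧ star x ⬝ᵥ (Λ *ᵥ (Λᴴ *ᵥ x)) = s := by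
    have := hG.dotProduct_mulVec_nonneg x
    rw [← mulVec_mulVec] at this
    rw [Complex.nonneg_iff] at this
    exact ⟨_, this.1, Complex.ext rfl this.2.symm⟩
  obtain ⟨c, hc, hcx⟩ : ∃ c : ℝ, 0 < c ∧ star x ⬝ᵥ x = c := by
    have := dotProduct_star_self_pos_iff.2 hx
    rw [Complex.pos_iff] at this
    exact ⟨_, this.1, Complex.ext rfl this.2.symm⟩
  refine hz.not_gt (norm_lt_one_of_mul_sub_mul_add_eq hα₀ hα₁ (mul_nonneg hτ.le hs)
    (mul_pos hσ2 hc) (z := z) ?_)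
  have key := congrArg (star x ⬝ᵥ ·) hEx
  simp only [hE, add_mulVec, smul_mulVec, one_mulVec, ← mulVec_mulVec, dotProduct_smul,
    dotProduct_add, hsx, hcx, smul_eq_mul] at key
  push_cast
  linear_combination key

/-- **Powers of the UT-AMP iteration matrix converge to zero.**
If `Λ ≠ 0`, then the matrix powers of the UT-AMP iteration matrix `C` converge to zero
(entrywise) as `t → ∞`. -/
theorem utamp_powers_tendsto_zero (M N : ℕ) (hM : 0 < M) (hN : 0 < N)
    (Λ : Matrix (Fin M) (Fin N) ℂ)
    (hΛ : ∀ (i : Fin M) (j : Fin N), (i : ℕ) ≠ (j : ℕ) → Λ i j = 0)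
    (hΛ0 : Λ ≠ 0)
    (V : Matrix (Fin N) (Fin N) ℂ)
    (hV : Vᴴ * V = 1) (hV' : V * Vᴴ = 1)
    (σ2 τ : ℝ) (hσ2 : 0 < σ2) (hτ : 0 < τ)
    (D : Matrix (Fin M) (Fin M) ℂ)
    (hD : D = ((τ : ℂ) • (Λ * Λᴴ) + (σ2 : ℂ) • (1 : Matrix (Fin M) (Fin M) ℂ))⁻¹)
    (α : ℝ)
    (hα : α = (1 / N) *
      ∑ i : Fin (Nat.min M N),
        τ * ‖Λ (Fin.castLE (Nat.min_le_left M N) i) (Fin.castLE (Nat.min_le_right M N) i)‖ ^ 2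
          / (τ * ‖Λ (Fin.castLE (Nat.min_le_left M N) i) (Fin.castLE (Nat.min_le_right M N) i)‖ ^ 2
              + σ2))
    (Cmat : Matrix (Fin M ⊕ Fin N) (Fin M ⊕ Fin N) ℂ)
    (hC : Cmat = fromBlocks
      ((τ : ℂ) • (D * (Λ * Λᴴ)))
      (-(D * (Λ * V)))
      (((τ : ℂ) ^ 2) • (Vᴴ * Λᴴ * (D * (Λ * Λᴴ))))
      ((α : ℂ) • (1 : Matrix (Fin N) (Fin N) ℂ) - (τ : ℂ) • (Vᴴ * Λᴴ * (D * (Λ * V))))) :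
    Filter.Tendsto (fun t : ℕ => Cmat ^ t) Filter.atTop (nhds 0) := by
  have hβ : ∀ a : ℝ, 0 ≤ τ * a ^ 2 / (τ * a ^ 2 + σ2) ∧ τ * a ^ 2 / (τ * a ^ 2 + σ2) < 1 := by
    intro a
    have : 0 ≤ τ * a ^ 2 := by positivity
    exact ⟨by positivity, (div_lt_one (by linarith)).2 (by linarith)⟩
  have hN' : (0 : ℝ) < N := by exact_mod_cast hN
  have hα₀ : 0 ≤ α := by
    rw [hα]
    exact mul_nonneg (by positivity) (Finset.sum_nonneg fun i _ => (hβ _).1)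
  have hα₁ : α < 1 := by
    have : Nonempty (Fin (Nat.min M N)) := ⟨⟨0, lt_min hM hN⟩⟩
    rw [hα, one_div, inv_mul_lt_iff₀ hN', mul_one]
    refine (Finset.sum_lt_sum_of_nonempty Finset.univ_nonempty fun i _ => (hβ _).2).trans_le ?_
    simp
  have : Nonempty (Fin M ⊕ Fin N) := ⟨Sum.inl ⟨0, hM⟩⟩
  refine Matrix.tendsto_pow_zero_of_eigenvalue_norm_lt_one Cmat fun z v hv h => ?_
  rw [hC] at h
  exact utamp_eigenvalue_norm_lt_one Λ V hV' hσ2 hτ hα₀ hα₁ D hD z v hv h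
end

section
/- (Theorem 1, linear-state form.) Suppose Λ ≠ 0. Then I_{M+N} − C is invertible, and for every vector e ∈ ℂ^{M+N} and every initial vector z⁰ ∈ ℂ^{M+N}, the affine iteration z^{t+1} = C z^t + e converges (entrywise) as t → ∞ to the unique fixed point (I_{M+N} − C)⁻¹ e. In other words, the UT-AMP iteration with Gaussian priors converges for any system matrix A = U Λ V. -/
open Matrix

open scoped ComplexOrder

/-- A quadratic `z² - a z + a b` with `a, b ∈ [0, 1)` has its roots in the open unit disc. -/
theorem norm_lt_one_of_sq_sub_mul_add_eq_zero {a b : ℝ} (ha0 : 0 ≤ a) (ha1 : a < 1)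
    (hb0 : 0 ≤ b) (hb1 : b < 1) {z : ℂ} (hz : z ^ 2 - a * z + a * b = 0) : ‖z‖ < 1 := by
  have hre := congrArg Complex.re hz
  have him := congrArg Complex.im hz
  simp only [pow_two, Complex.add_re, Complex.sub_re, Complex.mul_re, Complex.ofReal_re,
    Complex.ofReal_im, Complex.add_im, Complex.sub_im, Complex.mul_im, Complex.zero_re,
    Complex.zero_im] at hre him
  have hab : 0 ≤ a * b := mul_nonneg ha0 hb0
  have hab1 : a * b < 1 := by nlinarith
  suffices h : z.re * z.re + z.im * z.im < 1 by
    rw [← sq_lt_one_iff₀ (norm_nonneg z), ← Complex.normSq_eq_norm_sq, Complex.normSq_apply]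
    exact h
  rcases eq_or_ne z.im 0 with hy | hy
  · rw [hy] at hre ⊢
    have h1 : z.re < 1 := by nlinarith
    have h2 : -1 < z.re := by nlinarith
    nlinarith
  · have hx : 2 * z.re = a := by
      have : z.im * (2 * z.re - a) = 0 := by linear_combination him
      rcases mul_eq_zero.mp this with h | h
      · exact absurd h hy
      · linarith
    nlinarith

/-- The powers of an element of a complex Banach algebra whose spectrum lies in the open unit
disc tend to zero. -/
theorem tendsto_pow_zero_of_forall_spectrum_norm_lt_one {A : Type*} [NormedRing A]
    [NormedAlgebra ℂ A] [CompleteSpace A] [Nontrivial A] {a : A}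
    (h : ∀ z ∈ spectrum ℂ a, ‖z‖ < 1) :
    Filter.Tendsto (fun n : ℕ => a ^ n) Filter.atTop (nhds 0) := by
  have hr : spectralRadius ℂ a < 1 :=
    spectrum.spectralRadius_lt_of_forall_lt a (r := 1) fun z hz => by
      exact_mod_cast h z hz
  obtain ⟨r, har, hr1⟩ := exists_between hr
  have hlt := (spectrum.pow_nnnorm_pow_one_div_tendsto_nhds_spectralRadius a).eventually_lt_const har
  have hpow : Filter.Tendsto (fun n : ℕ => r ^ n) Filter.atTop (nhds 0) :=
    ENNReal.tendsto_pow_atTop_nhds_zero_iff.mpr hr1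
  have hle : ∀ᶠ n : ℕ in Filter.atTop, (‖a ^ n‖₊ : ENNReal) ≤ r ^ n := by
    filter_upwards [hlt, Filter.eventually_gt_atTop 0] with n hn hn0
    have := ENNReal.rpow_le_rpow hn.le (Nat.cast_nonneg n : (0 : ℝ) ≤ n)
    rwa [← ENNReal.rpow_mul, one_div_mul_cancel (by positivity), ENNReal.rpow_one,
      ENNReal.rpow_natCast] at this
  have hz := tendsto_of_tendsto_of_tendsto_of_le_of_le' tendsto_const_nhds hpow
    (Filter.Eventually.of_forall fun _ => zero_le) hle
  rw [tendsto_zero_iff_norm_tendsto_zero]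
  have := (ENNReal.tendsto_toReal ENNReal.zero_ne_top).comp hz
  simpa using! this

namespace Matrix

theorem fromBlocks_sub {l m n o R : Type*} [AddGroup R] (A A' : Matrix n l R) (B B' : Matrix n m R)
    (C C' : Matrix o l R) (D D' : Matrix o m R) :
    fromBlocks A B C D - fromBlocks A' B' C' D' =
      fromBlocks (A - A') (B - B') (C - C') (D - D') := by
  ext (i | i) (j | j) <;> rfl

section

variable {m n : Type*} [Fintype m] [Fintype n]

theorem PosSemidef.fromBlocks_diagonal {A : Matrix m m ℂ} {B : Matrix n n ℂ}
    (hA : A.PosSemidef) (hB : B.PosSemidef) : (fromBlocks A 0 0 B).PosSemidef := by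
  refine .of_dotProduct_mulVec_nonneg
    (IsHermitian.fromBlocks hA.1 (conjTranspose_zero) hB.1) fun x => ?_
  have h : star x ⬝ᵥ fromBlocks A 0 0 B *ᵥ x =
      star (x ∘ Sum.inl) ⬝ᵥ A *ᵥ (x ∘ Sum.inl) + star (x ∘ Sum.inr) ⬝ᵥ B *ᵥ (x ∘ Sum.inr) := by
    simp [fromBlocks_mulVec, dotProduct]
  rw [h]
  exact add_nonneg (hA.dotProduct_mulVec_nonneg _) (hB.dotProduct_mulVec_nonneg _)

variable [DecidableEq m]

theorem posDef_smul_mul_conjTranspose_add_smul_one (X : Matrix m n ℂ) {s t : ℝ} (hs : 0 < s)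
    (ht : 0 < t) : ((t : ℂ) • (X * Xᴴ) + (s : ℂ) • (1 : Matrix m m ℂ)).PosDef :=
  PosDef.posSemidef_add
    ((posSemidef_self_mul_conjTranspose X).smul (by exact_mod_cast ht.le))
    (PosDef.one.smul (by exact_mod_cast hs))

theorem posSemidef_smul_conjTranspose_mul_inv_mul (X : Matrix m n ℂ) {s t : ℝ} (hs : 0 < s)
    (ht : 0 < t) :
    ((t : ℂ) • (Xᴴ * (((t : ℂ) • (X * Xᴴ) + (s : ℂ) • (1 : Matrix m m ℂ))⁻¹ * X))).PosSemidef := by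
  rw [← Matrix.mul_assoc]
  exact ((posDef_smul_mul_conjTranspose_add_smul_one X hs ht).inv.posSemidef
    |>.conjTranspose_mul_mul_same X).smul (by exact_mod_cast ht.le)

theorem posDef_one_sub_smul_inv_mul (X : Matrix m n ℂ) {s t : ℝ} (hs : 0 < s) (ht : 0 < t) :
    (1 - (t : ℂ) • (((t : ℂ) • (X * Xᴴ) + (s : ℂ) • (1 : Matrix m m ℂ))⁻¹ * (X * Xᴴ))).PosDef := by
  have hK := posDef_smul_mul_conjTranspose_add_smul_one X hs ht
  have hdet := (isUnit_iff_isUnit_det _).mp hK.isUnit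
  have h := nonsing_inv_mul _ hdet
  rw [Matrix.mul_add, Matrix.mul_smul, Matrix.mul_smul, Matrix.mul_one] at h
  rw [sub_eq_of_eq_add' h.symm]
  exact hK.inv.smul (by exact_mod_cast hs)

variable [DecidableEq n]

theorem PosDef.fromBlocks_diagonal {A : Matrix m m ℂ} {B : Matrix n n ℂ}
    (hA : A.PosDef) (hB : B.PosDef) : (fromBlocks A 0 0 B).PosDef := by
  rw [(PosSemidef.fromBlocks_diagonal hA.posSemidef hB.posSemidef).posDef_iff_isUnit,
    isUnit_fromBlocks_zero₂₁]
  exact ⟨hA.isUnit, hB.isUnit⟩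

/-- If `C² = a (C - B)` with `0 ≤ B < 1` Hermitian and `0 ≤ a < 1`, then the eigenvalues of `C`
lie in the open unit disc. -/
theorem norm_lt_one_of_mem_spectrum_of_mul_self_eq {C B : Matrix n n ℂ} {a : ℝ} (ha0 : 0 ≤ a)
    (ha1 : a < 1) (hB : B.PosSemidef) (hB1 : (1 - B).PosDef)
    (hC : C * C = (a : ℂ) • (C - B)) {z : ℂ} (hz : z ∈ spectrum ℂ C) : ‖z‖ < 1 := by
  rw [← spectrum_toLin', ← Module.End.hasEigenvalue_iff_mem_spectrum] at hz
  obtain ⟨v, hv⟩ := hz.exists_hasEigenvector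
  have hv0 := hv.2
  have hCv : C *ᵥ v = z • v := by simpa using hv.apply_eq_smul
  have hq := hB.dotProduct_mulVec_nonneg v
  have hs := hB1.dotProduct_mulVec_pos hv0
  rw [sub_mulVec, one_mulVec, dotProduct_sub] at hs
  have key : star v ⬝ᵥ (C * C) *ᵥ v = star v ⬝ᵥ ((a : ℂ) • (C - B)) *ᵥ v := by rw [hC]
  rw [← mulVec_mulVec, hCv, mulVec_smul, hCv, smul_mulVec, sub_mulVec, hCv] at key
  simp only [dotProduct_smul, dotProduct_sub, smul_eq_mul] at key
  generalize star v ⬝ᵥ B *ᵥ v = q at *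
  have hs0 : 0 < star v ⬝ᵥ v := dotProduct_star_self_pos_iff.mpr hv0
  generalize star v ⬝ᵥ v = s at *
  lift s to ℝ using (Complex.nonneg_iff.mp hs0.le).2.symm
  lift q to ℝ using (Complex.nonneg_iff.mp hq).2.symm
  norm_cast at hs hs0 hq
  refine norm_lt_one_of_sq_sub_mul_add_eq_zero ha0 ha1 (b := q / s) (by positivity)
    ((div_lt_one hs0).mpr (by linarith)) ?_
  have : (s : ℂ) ≠ 0 := by exact_mod_cast hs0.ne'
  push_cast
  field_simp
  linear_combination key

/-- An affine iteration whose matrix has its spectrum in the open unit disc converges to its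
unique fixed point. -/
theorem tendsto_affine_iteration_of_spectrum [Nonempty n] {C : Matrix n n ℂ}
    (hC : ∀ z ∈ spectrum ℂ C, ‖z‖ < 1) :
    IsUnit (1 - C) ∧ ∀ (e : n → ℂ) (z : ℕ → n → ℂ), (∀ t, z (t + 1) = C *ᵥ z t + e) →
      Filter.Tendsto z Filter.atTop (nhds ((1 - C)⁻¹ *ᵥ e)) := by
  have hu : IsUnit (1 - C) := by
    by_contra h
    have := hC 1 (by rwa [spectrum.mem_iff, map_one])
    simp at this
  refine ⟨hu, fun e z hz => ?_⟩
  have hpow : Filter.Tendsto (fun t : ℕ => C ^ t) Filter.atTop (nhds 0) := by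
    let _ := Matrix.linftyOpNormedRing (n := n) (α := ℂ)
    let _ := Matrix.linftyOpNormedAlgebra (n := n) (R := ℂ) (α := ℂ)
    exact tendsto_pow_zero_of_forall_spectrum_norm_lt_one hC
  set w := (1 - C)⁻¹ *ᵥ e with hw
  have hfix : w = C *ᵥ w + e := by
    have : (1 - C) *ᵥ w = e := by
      rw [hw, mulVec_mulVec, mul_nonsing_inv _ ((isUnit_iff_isUnit_det _).mp hu), one_mulVec]
    rw [sub_mulVec, one_mulVec] at this
    rw [← this]
    abel
  have hform : ∀ t, z t = C ^ t *ᵥ (z 0 - w) + w := by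
    intro t
    induction t with
    | zero => simp
    | succ t ih =>
      rw [hz, ih, mulVec_add, mulVec_mulVec, ← pow_succ', add_assoc, ← hfix]
  have hlim : Filter.Tendsto (fun t : ℕ => C ^ t *ᵥ (z 0 - w) + w) Filter.atTop
      (nhds ((0 : Matrix n n ℂ) *ᵥ (z 0 - w) + w)) := by
    have hc : Continuous fun A : Matrix n n ℂ => A *ᵥ (z 0 - w) + w := by fun_prop
    exact (hc.tendsto 0).comp hpow
  rw [zero_mulVec, zero_add] at hlim
  exact hlim.congr fun t => (hform t).symm

/-- The push-through identity for the regularized Gram matrices of `X`. -/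
theorem inv_smul_mul_conjTranspose_add_mul (X : Matrix m n ℂ) {s t : ℝ} (hs : 0 < s)
    (ht : 0 < t) :
    ((t : ℂ) • (X * Xᴴ) + (s : ℂ) • (1 : Matrix m m ℂ))⁻¹ * X =
      X * ((t : ℂ) • (Xᴴ * X) + (s : ℂ) • (1 : Matrix n n ℂ))⁻¹ := by
  have hK := (posDef_smul_mul_conjTranspose_add_smul_one X hs ht).isUnit
  have hL := (posDef_smul_mul_conjTranspose_add_smul_one Xᴴ hs ht).isUnit
  rw [conjTranspose_conjTranspose] at hL
  rw [isUnit_iff_isUnit_det] at hK hL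
  set K := (t : ℂ) • (X * Xᴴ) + (s : ℂ) • (1 : Matrix m m ℂ)
  set L := (t : ℂ) • (Xᴴ * X) + (s : ℂ) • (1 : Matrix n n ℂ)
  have hKL : K * X = X * L := by
    simp [K, L, Matrix.add_mul, Matrix.mul_add, Matrix.mul_assoc]
  calc K⁻¹ * X = K⁻¹ * (X * L) * L⁻¹ := by
        rw [← Matrix.mul_assoc, mul_nonsing_inv_cancel_right _ _ hL]
    _ = X * L⁻¹ := by rw [← hKL, nonsing_inv_mul_cancel_left _ _ hK]

theorem posSemidef_smul_inv_mul (X : Matrix m n ℂ) {s t : ℝ} (hs : 0 < s) (ht : 0 < t) :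
    ((t : ℂ) • (((t : ℂ) • (X * Xᴴ) + (s : ℂ) • (1 : Matrix m m ℂ))⁻¹ * (X * Xᴴ))).PosSemidef := by
  have h := posSemidef_smul_conjTranspose_mul_inv_mul Xᴴ hs ht
  rw [conjTranspose_conjTranspose] at h
  rwa [← Matrix.mul_assoc, inv_smul_mul_conjTranspose_add_mul X hs ht, Matrix.mul_assoc]

theorem posDef_one_sub_smul_conjTranspose_mul_inv_mul (X : Matrix m n ℂ) {s t : ℝ} (hs : 0 < s)
    (ht : 0 < t) :
    (1 - (t : ℂ) • (Xᴴ * (((t : ℂ) • (X * Xᴴ) + (s : ℂ) • (1 : Matrix m m ℂ))⁻¹ * X))).PosDef := by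
  have h := posDef_one_sub_smul_inv_mul Xᴴ hs ht
  have hp := inv_smul_mul_conjTranspose_add_mul Xᴴ hs ht
  rw [conjTranspose_conjTranspose] at h hp
  rwa [← Matrix.mul_assoc, ← hp, Matrix.mul_assoc]

end

/-- The block matrix of the UT-AMP iteration satisfies the quadratic relation `C² = a (C - B)`
with `B` block diagonal. -/
theorem fromBlocks_mul_self_eq_smul_sub {m n : Type*} [Fintype m] [Fintype n] [DecidableEq n]
    (X : Matrix m n ℂ) (D : Matrix m m ℂ) (a t : ℂ) :
    fromBlocks (t • (D * (X * Xᴴ))) (-(D * X)) (t ^ 2 • (Xᴴ * (D * (X * Xᴴ))))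
        (a • (1 : Matrix n n ℂ) - t • (Xᴴ * (D * X))) *
      fromBlocks (t • (D * (X * Xᴴ))) (-(D * X)) (t ^ 2 • (Xᴴ * (D * (X * Xᴴ))))
        (a • (1 : Matrix n n ℂ) - t • (Xᴴ * (D * X))) =
    a • (fromBlocks (t • (D * (X * Xᴴ))) (-(D * X)) (t ^ 2 • (Xᴴ * (D * (X * Xᴴ))))
        (a • (1 : Matrix n n ℂ) - t • (Xᴴ * (D * X))) -
      fromBlocks (t • (D * (X * Xᴴ))) 0 0 (t • (Xᴴ * (D * X)))) := by
  rw [fromBlocks_multiply, fromBlocks_sub, fromBlocks_smul]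
  congr 1
  all_goals
    simp only [Matrix.mul_sub, Matrix.sub_mul, Matrix.mul_smul, Matrix.smul_mul, Matrix.mul_neg,
      Matrix.neg_mul, Matrix.mul_one, Matrix.one_mul, Matrix.mul_assoc, sub_zero]
    module

end Matrix

/-- An average of `β ∈ [0, 1)` over at most `N` indices lies in `[0, 1)`. -/
theorem inv_mul_sum_mem_Ico {k N : ℕ} (hN : 0 < N) (hk : k ≤ N) {β : Fin k → ℝ}
    (h0 : ∀ i, 0 ≤ β i) (h1 : ∀ i, β i < 1) :
    0 ≤ (1 / N : ℝ) * ∑ i, β i ∧ (1 / N : ℝ) * ∑ i, β i < 1 := by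
  have hN' : (0 : ℝ) < N := by exact_mod_cast hN
  refine ⟨mul_nonneg (by positivity) (Finset.sum_nonneg fun i _ => h0 i), ?_⟩
  rw [one_div_mul_eq_div, div_lt_one hN']
  rcases Nat.eq_zero_or_pos k with rfl | hk0
  · simpa using hN
  · have : Nonempty (Fin k) := ⟨⟨0, hk0⟩⟩
    calc ∑ i, β i < ∑ _i : Fin k, (1 : ℝ) :=
          Finset.sum_lt_sum_of_nonempty Finset.univ_nonempty fun i _ => h1 i
      _ = k := by simp
      _ ≤ N := by exact_mod_cast hk

/-- **Theorem 1 (linear-state form): UT-AMP with Gaussian priors converges for any `A`.**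
If `Λ ≠ 0`, then `I - C` is invertible and for every `e` and every initial vector `z⁰`, the
affine iteration `z^{t+1} = C z^t + e` converges to the unique fixed point `(I - C)⁻¹ e`. -/
theorem utamp_affine_iteration_converges (M N : ℕ) (hM : 0 < M) (hN : 0 < N)
    (Λ : Matrix (Fin M) (Fin N) ℂ)
    (hΛ : ∀ (i : Fin M) (j : Fin N), (i : ℕ) ≠ (j : ℕ) → Λ i j = 0)
    (hΛ0 : Λ ≠ 0)
    (V : Matrix (Fin N) (Fin N) ℂ)
    (hV : Vᴴ * V = 1) (hV' : V * Vᴴ = 1)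
    (σ2 τ : ℝ) (hσ2 : 0 < σ2) (hτ : 0 < τ)
    (D : Matrix (Fin M) (Fin M) ℂ)
    (hD : D = ((τ : ℂ) • (Λ * Λᴴ) + (σ2 : ℂ) • (1 : Matrix (Fin M) (Fin M) ℂ))⁻¹)
    (α : ℝ)
    (hα : α = (1 / N) *
      ∑ i : Fin (Nat.min M N),
        τ * ‖Λ (Fin.castLE (Nat.min_le_left M N) i) (Fin.castLE (Nat.min_le_right M N) i)‖ ^ 2
          / (τ * ‖Λ (Fin.castLE (Nat.min_le_left M N) i) (Fin.castLE (Nat.min_le_right M N) i)‖ ^ 2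
              + σ2))
    (Cmat : Matrix (Fin M ⊕ Fin N) (Fin M ⊕ Fin N) ℂ)
    (hC : Cmat = fromBlocks
      ((τ : ℂ) • (D * (Λ * Λᴴ)))
      (-(D * (Λ * V)))
      (((τ : ℂ) ^ 2) • (Vᴴ * Λᴴ * (D * (Λ * Λᴴ))))
      ((α : ℂ) • (1 : Matrix (Fin N) (Fin N) ℂ) - (τ : ℂ) • (Vᴴ * Λᴴ * (D * (Λ * V))))) :
    IsUnit (1 - Cmat) ∧
      ∀ (e z0 : Fin M ⊕ Fin N → ℂ) (z : ℕ → Fin M ⊕ Fin N → ℂ),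
        z 0 = z0 → (∀ t, z (t + 1) = Cmat *ᵥ z t + e) →
          Filter.Tendsto z Filter.atTop (nhds ((1 - Cmat)⁻¹ *ᵥ e)) := by
  obtain ⟨hα0, hα1⟩ : 0 ≤ α ∧ α < 1 := by
    rw [hα]
    refine inv_mul_sum_mem_Ico hN (Nat.min_le_right M N) (fun i => by positivity) fun i => ?_
    rw [div_lt_one (by positivity)]
    linarith
  have hX : Λ * Λᴴ = Λ * V * (Λ * V)ᴴ := by
    rw [conjTranspose_mul, Matrix.mul_assoc Λ V, ← Matrix.mul_assoc V, hV', Matrix.one_mul]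
  rw [← conjTranspose_mul, hX] at hC
  rw [hX] at hD
  generalize Λ * V = X at hC hD
  have hsq := fromBlocks_mul_self_eq_smul_sub X D α τ
  rw [← hC] at hsq
  have : Nonempty (Fin M ⊕ Fin N) := ⟨Sum.inl ⟨0, hM⟩⟩
  have hB : (fromBlocks ((τ : ℂ) • (D * (X * Xᴴ))) 0 0
      ((τ : ℂ) • (Xᴴ * (D * X)))).PosSemidef := by
    rw [hD]
    exact (posSemidef_smul_inv_mul X hσ2 hτ).fromBlocks_diagonal
      (posSemidef_smul_conjTranspose_mul_inv_mul X hσ2 hτ)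
  have hB1 : (1 - fromBlocks ((τ : ℂ) • (D * (X * Xᴴ))) 0 0
      ((τ : ℂ) • (Xᴴ * (D * X)))).PosDef := by
    rw [hD, ← fromBlocks_one, fromBlocks_sub, sub_zero, sub_zero]
    exact (posDef_one_sub_smul_inv_mul X hσ2 hτ).fromBlocks_diagonal
      (posDef_one_sub_smul_conjTranspose_mul_inv_mul X hσ2 hτ)
  obtain ⟨hu, hlim⟩ := tendsto_affine_iteration_of_spectrum fun z hz =>
    norm_lt_one_of_mem_spectrum_of_mul_self_eq hα0 hα1 hB hB1 hsq hz
  exact ⟨hu, fun e _ z _ hz => hlim e z hz⟩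
end

section
/- The UT-AMP Gaussian-prior variance-update map F maps (0, ∞) into (0, ∞) and is monotone nondecreasing: for all 0 < τ ≤ τ̂, one has 0 < F(τ) ≤ F(τ̂). Moreover F is bounded above by (1/N) Σ_{i=1}^{N} τ⁰_i. -/
/-- **The UT-AMP Gaussian-prior variance-update map is positive, monotone and bounded.**
The map `F` sending the variance `τ_x^t` to `τ_x^{t+1}` maps `(0,∞)` into `(0,∞)`, is monotone
nondecreasing there, and is bounded above by `(1/N) ∑ᵢ τ⁰ᵢ`. -/
theorem utamp_variance_map_monotone_bounded (M N : ℕ) (hM : 0 < M) (hN : 0 < N)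
    (lam : Fin (Nat.min M N) → ℂ) (hlam : lam ≠ 0)
    (σ2 : ℝ) (hσ2 : 0 < σ2)
    (τ0 : Fin N → ℝ) (hτ0 : ∀ i, 0 < τ0 i)
    (τq : ℝ → ℝ)
    (hτq : ∀ τ, τq τ = ((1 / N) * ∑ i, ‖lam i‖ ^ 2 / (τ * ‖lam i‖ ^ 2 + σ2))⁻¹)
    (F : ℝ → ℝ)
    (hF : ∀ τ, F τ = (1 / N) * ∑ i, τq τ * τ0 i / (τq τ + τ0 i)) :
    (∀ τ τ' : ℝ, 0 < τ → τ ≤ τ' → 0 < F τ ∧ F τ ≤ F τ') ∧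
    (∀ τ : ℝ, 0 < τ → F τ ≤ (1 / N) * ∑ i, τ0 i) := by
  have hN' : (0 : ℝ) < 1 / N := by positivity
  obtain ⟨k, hk⟩ := Function.ne_iff.mp hlam
  have hk' : 0 < ‖lam k‖ := norm_pos_iff.mpr hk
  have hden : ∀ τ : ℝ, 0 < τ → ∀ i, 0 < τ * ‖lam i‖ ^ 2 + σ2 := fun τ hτ i => by positivity
  have hsum : ∀ τ : ℝ, 0 < τ → 0 < ∑ i, ‖lam i‖ ^ 2 / (τ * ‖lam i‖ ^ 2 + σ2) := fun τ hτ =>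
    Finset.sum_pos' (fun i _ => div_nonneg (sq_nonneg _) (hden τ hτ i).le)
      ⟨k, Finset.mem_univ k, div_pos (pow_pos hk' 2) (hden τ hτ k)⟩
  have hq_pos : ∀ τ : ℝ, 0 < τ → 0 < τq τ := fun τ hτ => by
    rw [hτq]
    exact inv_pos.mpr (mul_pos hN' (hsum τ hτ))
  have hq_mono : ∀ τ τ' : ℝ, 0 < τ → τ ≤ τ' → τq τ ≤ τq τ' := fun τ τ' hτ h => by
    rw [hτq, hτq]
    refine inv_anti₀ (mul_pos hN' (hsum τ' (hτ.trans_le h)))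
      (mul_le_mul_of_nonneg_left (Finset.sum_le_sum fun i _ => ?_) hN'.le)
    exact div_le_div_of_nonneg_left (sq_nonneg _) (hden τ hτ i) (by gcongr)
  refine ⟨fun τ τ' hτ h => ?_, fun τ hτ => ?_⟩
  · have hq := hq_pos τ hτ
    have hq' := hq_pos τ' (hτ.trans_le h)
    have hqq := hq_mono τ τ' hτ h
    rw [hF, hF]
    refine ⟨mul_pos hN' (Finset.sum_pos (fun i _ => ?_) ⟨⟨0, hN⟩, Finset.mem_univ _⟩),
      mul_le_mul_of_nonneg_left (Finset.sum_le_sum fun i _ => ?_) hN'.le⟩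
    · have := hτ0 i
      positivity
    · have := hτ0 i
      rw [div_le_div_iff₀ (by positivity) (by positivity)]
      nlinarith [mul_le_mul_of_nonneg_right hqq (mul_pos this this).le]
  · have hq := hq_pos τ hτ
    rw [hF]
    refine mul_le_mul_of_nonneg_left (Finset.sum_le_sum fun i _ => ?_) hN'.le
    have := hτ0 i
    rw [div_le_iff₀ (by positivity)]
    nlinarith [mul_pos this this]
end

section
/- For every initial value τ_init > 0, the sequence defined by τ^0 = τ_init and τ^{t+1} = F(τ^t) is monotone (nondecreasing if F(τ_init) ≥ τ_init, nonincreasing otherwise) and converges to a limit τ* > 0 satisfying F(τ*) = τ*. In other words, the UT-AMP variance parameter with Gaussian priors always converges to a fixed point, for any choice of the λ_i. -/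
open Filter Topology in
/-- Iterates of a continuous monotone self-map of `[0, ∞)` with values in `[m, B]`, `m > 0`,
are monotone and converge to a positive fixed point. -/
theorem iterate_monotone_and_tendsto_fixedPoint {F : ℝ → ℝ} {m B : ℝ} (hm : 0 < m)
    (hmono : MonotoneOn F (Set.Ici 0)) (hcont : ∀ x, 0 < x → ContinuousAt F x)
    (hlow : ∀ x, 0 ≤ x → m ≤ F x) (hupp : ∀ x, 0 ≤ x → F x ≤ B)
    {s : ℕ → ℝ} (hs0 : 0 < s 0) (hs : ∀ t, s (t + 1) = F (s t)) :
    ((s 0 ≤ F (s 0) → Monotone s) ∧ (F (s 0) < s 0 → Antitone s)) ∧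
      ∃ x, 0 < x ∧ F x = x ∧ Tendsto s atTop (𝓝 x) := by
  have hpos : ∀ t, 0 < s t := by
    intro t
    induction t with
    | zero => exact hs0
    | succ t ih => rw [hs]; exact hm.trans_le (hlow _ ih.le)
  have hlow' : ∀ t, min (s 0) m ≤ s t := by
    rintro (_ | t)
    · exact min_le_left _ _
    · rw [hs]; exact (min_le_right _ _).trans (hlow _ (hpos t).le)
  have hupp' : ∀ t, s t ≤ max (s 0) B := by
    rintro (_ | t)
    · exact le_max_left _ _
    · rw [hs]; exact (hupp _ (hpos t).le).trans (le_max_right _ _)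
  have hup : s 0 ≤ F (s 0) → Monotone s := by
    intro h
    refine monotone_nat_of_le_succ fun t => ?_
    induction t with
    | zero => rw [hs]; exact h
    | succ t ih =>
      rw [hs (t + 1)]
      nth_rewrite 1 [hs t]
      exact hmono (hpos _).le (hpos _).le ih
  have hdown : F (s 0) < s 0 → Antitone s := by
    intro h
    refine antitone_nat_of_succ_le fun t => ?_
    induction t with
    | zero => rw [hs]; exact h.le
    | succ t ih =>
      rw [hs (t + 1)]
      nth_rewrite 2 [hs t]
      exact hmono (hpos _).le (hpos _).le ih
  refine ⟨⟨hup, hdown⟩, ?_⟩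
  obtain ⟨x, hx⟩ : ∃ x, Tendsto s atTop (𝓝 x) := by
    rcases le_or_gt (s 0) (F (s 0)) with h | h
    · exact ⟨_, tendsto_atTop_ciSup (hup h) ⟨_, by rintro _ ⟨t, rfl⟩; exact hupp' t⟩⟩
    · exact ⟨_, tendsto_atTop_ciInf (hdown h) ⟨_, by rintro _ ⟨t, rfl⟩; exact hlow' t⟩⟩
  have hx0 : 0 < x := (lt_min hs0 hm).trans_le (ge_of_tendsto' hx hlow')
  refine ⟨x, hx0, ?_, hx⟩
  have h1 : Tendsto (fun t => s (t + 1)) atTop (𝓝 (F x)) := by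
    simp only [hs]
    exact (hcont x hx0).tendsto.comp hx
  exact tendsto_nhds_unique h1 (hx.comp (tendsto_add_atTop_nat 1))

/-- The map `q ↦ q t / (q + t)` is monotone on the positive reals. -/
theorem mul_div_add_le_mul_div_add {p q t : ℝ} (hp : 0 < p) (hpq : p ≤ q) (ht : 0 < t) :
    p * t / (p + t) ≤ q * t / (q + t) := by
  rw [div_le_div_iff₀ (by linarith) (by linarith)]
  nlinarith [mul_nonneg (sub_nonneg.2 hpq) (sq_nonneg t)]


/-- **The UT-AMP variance parameter with Gaussian priors always converges to a fixed point.**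
For every initial value `τ_init > 0`, the sequence `τ⁰ = τ_init`, `τ^{t+1} = F(τ^t)` is monotone
(nondecreasing if `F(τ_init) ≥ τ_init`, nonincreasing otherwise) and converges to a limit
`τ* > 0` satisfying `F(τ*) = τ*`. -/
theorem utamp_variance_converges (M N : ℕ) (hM : 0 < M) (hN : 0 < N)
    (lam : Fin (Nat.min M N) → ℂ) (hlam : lam ≠ 0)
    (σ2 : ℝ) (hσ2 : 0 < σ2)
    (τ0 : Fin N → ℝ) (hτ0 : ∀ i, 0 < τ0 i)
    (τq : ℝ → ℝ)
    (hτq : ∀ τ, τq τ = ((1 / N) * ∑ i, ‖lam i‖ ^ 2 / (τ * ‖lam i‖ ^ 2 + σ2))⁻¹)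
    (F : ℝ → ℝ)
    (hF : ∀ τ, F τ = (1 / N) * ∑ i, τq τ * τ0 i / (τq τ + τ0 i)) :
    ∀ τinit : ℝ, 0 < τinit →
      ∀ τs : ℕ → ℝ, τs 0 = τinit → (∀ t, τs (t + 1) = F (τs t)) →
        ((τinit ≤ F τinit → Monotone τs) ∧ (F τinit < τinit → Antitone τs)) ∧
        ∃ τstar : ℝ, 0 < τstar ∧ F τstar = τstar ∧
          Filter.Tendsto τs Filter.atTop (nhds τstar) := by
  rintro τinit hinit s rfl hs
  have hN' : (0 : ℝ) < N := Nat.cast_pos.2 hN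
  have hden : ∀ τ : ℝ, 0 ≤ τ → ∀ i, 0 < τ * ‖lam i‖ ^ 2 + σ2 := fun τ hτ i => by positivity
  have hmean : ∀ τ : ℝ, 0 ≤ τ →
      0 < (1 / (N : ℝ)) * ∑ i, ‖lam i‖ ^ 2 / (τ * ‖lam i‖ ^ 2 + σ2) := by
    intro τ hτ
    obtain ⟨j, hj⟩ := Function.ne_iff.1 hlam
    have hj' : 0 < ‖lam j‖ := norm_pos_iff.2 hj
    refine mul_pos (by positivity) (Finset.sum_pos' (fun i _ => ?_) ⟨j, Finset.mem_univ j, ?_⟩)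
    · exact div_nonneg (sq_nonneg _) (hden τ hτ i).le
    · exact div_pos (by positivity) (hden τ hτ j)
  have hqpos : ∀ τ, 0 ≤ τ → 0 < τq τ := fun τ hτ => by
    rw [hτq]; exact inv_pos.2 (hmean τ hτ)
  have hqmono : ∀ a b, 0 ≤ a → a ≤ b → τq a ≤ τq b := by
    intro a b ha hab
    rw [hτq, hτq]
    refine inv_anti₀ (hmean b (ha.trans hab)) ?_
    refine mul_le_mul_of_nonneg_left (Finset.sum_le_sum fun i _ => ?_) (by positivity)
    refine div_le_div_of_nonneg_left (sq_nonneg _) (hden a ha i) ?_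
    gcongr
  have hmono : MonotoneOn F (Set.Ici 0) := by
    intro a ha b _ hab
    rw [hF, hF]
    refine mul_le_mul_of_nonneg_left (Finset.sum_le_sum fun i _ => ?_) (by positivity)
    exact mul_div_add_le_mul_div_add (hqpos a ha) (hqmono a b ha hab) (hτ0 i)
  have hF0 : 0 < F 0 := by
    rw [hF]
    refine mul_pos (by positivity) (Finset.sum_pos (fun i _ => ?_) ⟨⟨0, hN⟩, Finset.mem_univ _⟩)
    have := hqpos 0 le_rfl
    have := hτ0 i
    positivity
  refine iterate_monotone_and_tendsto_fixedPoint hF0 hmono (fun τ hτ => ?_)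
    (fun τ hτ => hmono (Set.mem_Ici.2 le_rfl) hτ hτ) (B := (1 / N) * ∑ i, τ0 i)
    (fun τ hτ => ?_) hinit hs
  · have hq : ContinuousAt τq τ := by
      rw [funext hτq]
      refine ContinuousAt.inv₀ ?_ (hmean τ hτ.le).ne'
      refine continuousAt_const.mul (tendsto_finsetSum _ fun i _ => ?_)
      exact ContinuousAt.div (by fun_prop) (by fun_prop) (hden τ hτ.le i).ne'
    rw [funext hF]
    refine continuousAt_const.mul (tendsto_finsetSum _ fun i _ => ?_)
    exact (hq.mul_const _).div (hq.add_const _) (add_pos (hqpos τ hτ.le) (hτ0 i)).ne'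
  · rw [hF]
    refine mul_le_mul_of_nonneg_left (Finset.sum_le_sum fun i _ => ?_) (by positivity)
    have hq := hqpos τ hτ
    have ht := hτ0 i
    rw [div_le_iff₀ (by linarith)]
    nlinarith
end
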